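/- In any tournament on n players with n a power of two, every king whose out-degree is at least n/2 is an SE winner. -/

import Mathlib

/-- A tournament relation on `V`: irreflexive, asymmetric, and total. -/
structure IsTournament {V : Type*} (beats : V → V → Prop) : Prop where
  irrefl : ∀ v, ¬ beats v v
  asymm : ∀ u v, beats u v → ¬ beats v u
  total : ∀ u v, u ≠ v → beats u v ∨ beats v u

/-- `SEWinner beats S v` : the player `v` can win a balanced single-elimination
tournament among the players of `S` under some seeding.  Either `S = {v}`, or `S`
can be partitioned into pairs (via a fixed-point-free involution `f` of `S`) such
that `v` is an SE winner of the set `W` of winners of the pairs. -/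
inductive SEWinner {V : Type*} (beats : V → V → Prop) : Finset V → V → Prop
  | single (v : V) : SEWinner beats {v} v
  | round (S W : Finset V) (f : V → V) (v : V)
      (hf : ∀ x ∈ S, f x ∈ S ∧ f x ≠ x ∧ f (f x) = x)
      (hW : ∀ x, x ∈ W ↔ x ∈ S ∧ beats x (f x))
      (hw : SEWinner beats W v) : SEWinner beats S v

/-- A king: every other player is beaten by `v` or by someone `v` beats. -/
def IsKing {V : Type*} (beats : V → V → Prop) (v : V) : Prop :=
  ∀ u, u ≠ v → beats v u ∨ ∃ w, beats v w ∧ beats w u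

/-- A 3-king: every other player is reachable from `v` in at most 3 steps. -/
def IsThreeKing {V : Type*} (beats : V → V → Prop) (v : V) : Prop :=
  ∀ u, u ≠ v → beats v u ∨ (∃ w, beats v w ∧ beats w u) ∨
    ∃ w x, beats v w ∧ beats w x ∧ beats x u

/-- The out-degree of a player. -/
noncomputable def outDeg {V : Type*} [Fintype V] (beats : V → V → Prop) (v : V) : ℕ :=
  {u | beats v u}.ncard

/-- The number of directed `k`-paths originating at `v`. -/
noncomputable def kPathCount {V : Type*} [Fintype V] (beats : V → V → Prop) (k : ℕ) (v : V) : ℕ :=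
  {p : Fin (k + 1) → V | Function.Injective p ∧ p 0 = v ∧
    ∀ i : Fin k, beats (p i.castSucc) (p i.succ)}.ncard

/-- A superking: a king `v` such that every player beating `v` is beaten by at
least `log₂ n` players whom `v` beats. -/
def IsSuperking {V : Type*} [Fintype V] (beats : V → V → Prop) (v : V) : Prop :=
  IsKing beats v ∧ ∀ u, beats u v →
    Real.logb 2 (Fintype.card V) ≤ ({w | beats v w ∧ beats w u}.ncard : ℝ)

/-- `Rnd beats S W`: `S` can be paired up so that `W` is the set of winners. -/
inductive Rnd {V : Type*} [DecidableEq V] (beats : V → V → Prop) : Finset V → Finset V → Prop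
  | nil : Rnd beats ∅ ∅
  | cons (S W : Finset V) (x y : V) (h : Rnd beats S W) (hx : x ∉ S) (hy : y ∉ S)
      (hxy : beats x y) : Rnd beats (insert x (insert y S)) (insert x W)

theorem Rnd.sub {V : Type*} [DecidableEq V] {beats : V → V → Prop} {S W : Finset V}
    (h : Rnd beats S W) : W ⊆ S := by
  induction h with
  | nil => simp
  | cons S W x y h hx hy hxy ih =>
    intro z hz
    have := @ih z
    grind

theorem Rnd.card {V : Type*} [DecidableEq V] {beats : V → V → Prop} (hT : IsTournament beats)
    {S W : Finset V} (h : Rnd beats S W) : S.card = 2 * W.card := by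
  induction h with
  | nil => simp
  | cons S W x y h hx hy hxy ih =>
    have hne : x ≠ y := fun e => hT.irrefl y (e ▸ hxy)
    have hxW : x ∉ W := fun e => hx (h.sub e)
    rw [Finset.card_insert_of_notMem (by simp [hne, hx]), Finset.card_insert_of_notMem hy,
      Finset.card_insert_of_notMem hxW]
    omega

theorem Rnd.exists_f {V : Type*} [DecidableEq V] {beats : V → V → Prop} (hT : IsTournament beats)
    {S W : Finset V} (h : Rnd beats S W) :
    ∃ f : V → V, (∀ x ∈ S, f x ∈ S ∧ f x ≠ x ∧ f (f x) = x) ∧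
      (∀ x, x ∈ W ↔ x ∈ S ∧ beats x (f x)) := by
  induction h with
  | nil => exact ⟨id, by simp, by simp⟩
  | cons S W x y h hx hy hxy ih =>
    obtain ⟨f, hf, hW⟩ := ih
    have hne : x ≠ y := fun e => hT.irrefl y (e ▸ hxy)
    have hyx := hT.asymm _ _ hxy
    refine ⟨fun z => if z = x then y else if z = y then x else f z, ?_, ?_⟩
    · intro z hz
      have := hf z
      grind
    · intro z
      have := hW z
      have := hf z
      grind

theorem Rnd.union {V : Type*} [DecidableEq V] {beats : V → V → Prop}
    {S W S' W' : Finset V} (h : Rnd beats S W) (h' : Rnd beats S' W') (hd : Disjoint S S') :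
    Rnd beats (S ∪ S') (W ∪ W') := by
  induction h with
  | nil => simpa using h'
  | cons S W x y h hx hy hxy ih =>
    simp only [Finset.disjoint_insert_left] at hd
    have := Rnd.cons _ _ x y (ih hd.2.2) (by simp [hx, hd.1]) (by simp [hy, hd.2.1]) hxy
    simpa [Finset.insert_union] using this

theorem Rnd.pair {V : Type*} [DecidableEq V] {beats : V → V → Prop} {x y : V} (h : beats x y) :
    Rnd beats {x, y} {x} := by
  have := Rnd.cons _ _ x y (Rnd.nil (beats := beats)) (by simp) (by simp) h
  simpa using this

theorem Rnd.even {V : Type*} [DecidableEq V] {beats : V → V → Prop} (hT : IsTournament beats)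
    (n : ℕ) : ∀ S : Finset V, S.card = 2 * n → ∃ W, Rnd beats S W := by
  induction n with
  | zero =>
    intro S hS
    obtain rfl : S = ∅ := by simpa using hS
    exact ⟨∅, Rnd.nil⟩
  | succ n ih =>
    intro S hS
    obtain ⟨x, hx, y, hy, hne⟩ := Finset.one_lt_card.1 (show 1 < S.card by omega)
    have hc : ((S.erase x).erase y).card = 2 * n := by
      rw [Finset.card_erase_of_mem (by simp [hy, hne.symm]), Finset.card_erase_of_mem hx]
      omega
    obtain ⟨W, hW⟩ := ih _ hc
    rcases hT.total x y hne with h | h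
    · refine ⟨insert x W, ?_⟩
      have := Rnd.cons _ _ x y hW (by simp) (by simp) h
      convert this using 1
      ext z; grind
    · refine ⟨insert y W, ?_⟩
      have := Rnd.cons _ _ y x hW (by simp) (by simp) h
      convert this using 1
      ext z; grind

theorem Rnd.greedy {V : Type*} [DecidableEq V] {beats : V → V → Prop} 
    (n : ℕ) : ∀ A B : Finset V, A.card = n → Disjoint A B → ∃ A1 B1, A1 ⊆ A ∧ B1 ⊆ B ∧
      A1.card = B1.card ∧ Rnd beats (A1 ∪ B1) A1 ∧
      ∀ a ∈ A \ A1, ∀ b ∈ B \ B1, ¬ beats a b := by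
  induction n with
  | zero =>
    intro A B hA _
    obtain rfl : A = ∅ := by simpa using hA
    exact ⟨∅, ∅, by simp, by simp, rfl, by simpa using Rnd.nil, by simp⟩
  | succ n ih =>
    intro A B hA hd
    by_cases hE : ∃ a ∈ A, ∃ b ∈ B, beats a b
    · obtain ⟨a, ha, b, hb, hab⟩ := hE
      have hd' : Disjoint (A.erase a) (B.erase b) :=
        hd.mono (Finset.erase_subset _ _) (Finset.erase_subset _ _)
      obtain ⟨A1, B1, hA1, hB1, hc, hR, hm⟩ := ih (A.erase a) (B.erase b)
        (by rw [Finset.card_erase_of_mem ha]; omega) hd'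
      have haA : a ∉ A1 := fun h => by simpa using hA1 h
      have hbB : b ∉ B1 := fun h => by simpa using hB1 h
      have haB : a ∉ B1 := fun h =>
        Finset.disjoint_left.1 hd ha (Finset.mem_of_mem_erase (hB1 h))
      have hbA : b ∉ A1 := fun h =>
        Finset.disjoint_left.1 hd (Finset.mem_of_mem_erase (hA1 h)) hb
      refine ⟨insert a A1, insert b B1, ?_, ?_, ?_, ?_, ?_⟩
      · intro z hz
        have := @hA1 z
        grind
      · intro z hz
        have := @hB1 z
        grind
      · rw [Finset.card_insert_of_notMem haA, Finset.card_insert_of_notMem hbB, hc]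
      · have := Rnd.cons _ _ a b hR (by simp [haA, haB]) (by simp [hbA, hbB]) hab
        convert this using 1
        ext z; grind
      · intro x hx y hy
        exact hm x (by grind) y (by grind)
    · push Not at hE
      exact ⟨∅, ∅, by simp, by simp, rfl, by simpa using Rnd.nil, by simpa using hE⟩

theorem Rnd.parity {V : Type*} [DecidableEq V] {beats : V → V → Prop} (hT : IsTournament beats)
    (A B : Finset V) (hd : Disjoint A B) (hp : A.card % 2 = B.card % 2)
    (hm : ∀ a ∈ A, ∀ b ∈ B, ¬ beats a b) :
    ∃ WA WB, WA ⊆ A ∧ WB ⊆ B ∧ Rnd beats (A ∪ B) (WA ∪ WB) ∧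
      2 * WA.card + A.card % 2 = A.card := by
  rcases Nat.mod_two_eq_zero_or_one A.card with h | h
  · obtain ⟨WA, hA⟩ := Rnd.even hT (A.card / 2) A (by omega)
    obtain ⟨WB, hB⟩ := Rnd.even hT (B.card / 2) B (by omega)
    have := hA.card hT
    exact ⟨WA, WB, hA.sub, hB.sub, hA.union hB hd, by omega⟩
  · obtain ⟨a, ha⟩ := Finset.card_pos.1 (show 0 < A.card by omega)
    obtain ⟨b, hb⟩ := Finset.card_pos.1 (show 0 < B.card by omega)
    have hcA := Finset.card_erase_of_mem ha
    have hcB := Finset.card_erase_of_mem hb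
    obtain ⟨WA, hA⟩ := Rnd.even hT (A.card / 2) (A.erase a) (by omega)
    obtain ⟨WB, hB⟩ := Rnd.even hT (B.card / 2) (B.erase b) (by omega)
    have hc := hA.card hT
    have hne : b ≠ a := fun e => Finset.disjoint_left.1 hd ha (e ▸ hb)
    have hba : beats b a := (hT.total b a hne).resolve_right (hm a ha b hb)
    have hU := hA.union hB (hd.mono (Finset.erase_subset _ _) (Finset.erase_subset _ _))
    have hnd := fun z (h : z ∈ A) => Finset.disjoint_left.1 hd h
    have := Rnd.cons _ _ b a hU (by grind) (by grind) hba
    refine ⟨WA, insert b WB, hA.sub.trans (Finset.erase_subset _ _), ?_, ?_, by omega⟩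
    · intro z hz
      have hs : z ∈ WB → z ∈ B.erase b := fun h => hB.sub h
      grind
    · convert this using 1
      · ext z; grind
      · ext z; grind

theorem SE_main {V : Type*} [DecidableEq V] {beats : V → V → Prop} (hT : IsTournament beats)
    (v : V) (k : ℕ) : ∀ (S A : Finset V), S.card = 2 ^ k → v ∈ S →
      (∀ u ∈ A, u ∈ S ∧ beats v u) → (∀ u ∈ S, beats v u → u ∈ A) →
      (∀ u ∈ S, u ≠ v → beats v u ∨ ∃ w ∈ S, beats v w ∧ beats w u) →
      2 ^ k ≤ 2 * A.card + 1 → SEWinner beats S v := by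
  induction k with
  | zero =>
    intro S A hS hv _ _ _ _
    obtain ⟨x, rfl⟩ := Finset.card_eq_one.1 (by simpa using hS)
    obtain rfl : v = x := by simpa using hv
    exact SEWinner.single v
  | succ k ih =>
    intro S A hS hv hA hA' hK hdeg
    have hvA : v ∉ A := fun h => hT.irrefl v (hA v h).2
    obtain ⟨B, hBdef⟩ : ∃ B, B = (S \ A).erase v := ⟨_, rfl⟩
    have hdAB : Disjoint A B := by
      rw [Finset.disjoint_left]; grind
    have hSeq : S = insert v (A ∪ B) := by
      ext z; have := hA z; grind
    have hvB : v ∉ B := by grind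
    have hScard : S.card = A.card + B.card + 1 := by
      rw [hSeq, Finset.card_insert_of_notMem (by simp [hvA, hvB]),
        Finset.card_union_of_disjoint hdAB]
    obtain ⟨A1, B1, hA1, hB1, hc1, hR1, hm⟩ := Rnd.greedy (beats := beats) A.card A B rfl hdAB
    have hB1c := Finset.card_le_card hB1
    have hcA := Finset.card_sdiff_of_subset hA1
    have hcB := Finset.card_sdiff_of_subset hB1
    rw [pow_succ] at hS hdeg
    obtain ⟨a0, ha0⟩ := Finset.card_pos.1 (show 0 < (A \ A1).card by omega)
    have hcA2 := Finset.card_erase_of_mem ha0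
    have hA1c := Finset.card_le_card hA1
    obtain ⟨WA, WB, hWA, hWB, hR2, hc2⟩ := Rnd.parity hT ((A \ A1).erase a0) (B \ B1)
      (hdAB.mono ((Finset.erase_subset _ _).trans Finset.sdiff_subset) Finset.sdiff_subset)
      (by omega) (fun a ha b hb => hm a (Finset.mem_of_mem_erase ha) b hb)
    have hva0 : beats v a0 := (hA a0 (Finset.mem_sdiff.1 ha0).1).2
    have hdl := fun z (h : z ∈ A) => Finset.disjoint_left.1 hdAB h
    have hWA' : ∀ z ∈ WA, z ∈ A ∧ z ∉ A1 := fun z hz => by have := hWA hz; grind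
    have hWB' : ∀ z ∈ WB, z ∈ B ∧ z ∉ B1 := fun z hz => by have := hWB hz; grind
    have hA1' : ∀ z ∈ A1, z ∈ A := fun z hz => hA1 hz
    have hB1' : ∀ z ∈ B1, z ∈ B := fun z hz => hB1 hz
    have hR3 := hR1.union hR2 (by rw [Finset.disjoint_left]; grind)
    have hR4 := Rnd.cons _ _ v a0 hR3 (by grind) (by grind) hva0
    have hSS : insert v (insert a0 (A1 ∪ B1 ∪ ((A \ A1).erase a0 ∪ (B \ B1)))) = S := by
      rw [hSeq]; ext z; grind
    rw [hSS] at hR4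
    have hWc := hR4.card hT
    have hWS := hR4.sub
    obtain ⟨f, hf, hW⟩ := hR4.exists_f hT
    refine SEWinner.round S _ f v hf hW (ih _ (A1 ∪ WA) (by omega) (by simp) ?_ ?_ ?_ ?_)
    · intro u hu
      have := hA u
      grind
    · intro u hu hb
      have h1 := hA' u (hWS hu) hb
      have := hT.irrefl v
      grind
    · intro u hu hne
      rcases hK u (hWS hu) hne with h | ⟨w, hwS, hvw, hwu⟩
      · exact Or.inl h
      · have hwA := hA' w hwS hvw
        by_cases huA : u ∈ A
        · exact Or.inl (hA u huA).2
        · refine Or.inr ⟨w, ?_, hvw, hwu⟩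
          have := hm w
          by_cases hw1 : w ∈ A1
          · simp [hw1]
          · exact absurd hwu (hm w (by simp [hwA, hw1]) u (by grind))
    · rw [Finset.card_union_of_disjoint (by rw [Finset.disjoint_left]; grind)]
      have hpos : B.card ≠ 0 → A1.card ≠ 0 := by
        intro hB h0
        obtain ⟨b, hb⟩ := Finset.card_pos.1 (Nat.pos_of_ne_zero hB)
        have hA0 : A1 = ∅ := by simpa using h0
        have hB0 : B1 = ∅ := by simpa [h0] using hc1.symm
        have hbS : b ∈ S := by grind
        rcases hK b hbS (by grind) with h | ⟨w, hwS, hvw, hwu⟩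
        · have := hA' b hbS h
          grind
        · exact hm w (by simp [hA0, hA' w hwS hvw]) b (by simp [hB0, hb]) hwu
      omega

/-- every king who beats at least half of the players is an SE
winner. -/
theorem king_high_outdegree_SE_winner {V : Type*} [Fintype V]
    (beats : V → V → Prop) (hT : IsTournament beats)
    (k : ℕ) (hcard : Fintype.card V = 2 ^ k)
    (v : V) (hking : IsKing beats v)
    (hdeg : Fintype.card V ≤ 2 * outDeg beats v) :
    SEWinner beats Finset.univ v := by
  classical
  unfold outDeg at hdeg
  refine SE_main hT v k Finset.univ (Finset.univ.filter (fun u => beats v u)) ?_ (by simp)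
    (by simp) (by simp) ?_ ?_
  · simpa using hcard
  · intro u _ hu
    simpa using hking u hu
  · have he : {u | beats v u} = ((Finset.univ.filter (fun u => beats v u) : Finset V) : Set V) := by
      ext u; simp
    rw [he, Set.ncard_coe_finset, hcard] at hdeg
    exact hdeg.trans (Nat.le_succ _)
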